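/- For random variables X and Y taking values in finite alphabets and any γ ≥ 0, the relaxed Wyner's common information satisfies the lower bound C_γ(X;Y) ≥ max{ I(X;Y) − γ, 0 }. -/

import Mathlib

open scoped BigOperators
open Classical

noncomputable section

/-- `p` is a probability mass function on the finite alphabet `α`. -/
def IsPMF {α : Type*} [Fintype α] (p : α → ℝ) : Prop :=
  (∀ a, 0 ≤ p a) ∧ ∑ a, p a = 1

/-- Pushforward of a pmf under a map (distribution of `f(X)` when `X ~ p`). -/
noncomputable def pmfMap {α β : Type*} [Fintype α] (f : α → β) (p : α → ℝ) : β → ℝ :=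
  fun b => ∑ a, if f a = b then p a else 0

/-- Shannon entropy (in nats) of a pmf on a finite alphabet. -/
noncomputable def Hent {α : Type*} [Fintype α] (p : α → ℝ) : ℝ :=
  ∑ a, Real.negMulLog (p a)

/-- Mutual information `I(X;Y)` of a joint pmf `p` of the pair `(X,Y)`. -/
noncomputable def mi {α β : Type*} [Fintype α] [Fintype β] (p : α × β → ℝ) : ℝ :=
  Hent (pmfMap Prod.fst p) + Hent (pmfMap Prod.snd p) - Hent p

/-- Mutual information `I(X,Y;W)` of a joint pmf `q` of the triple `((X,Y),W)`. -/
noncomputable def miW {α β W : Type*} [Fintype α] [Fintype β] [Fintype W]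
    (q : (α × β) × W → ℝ) : ℝ :=
  Hent (pmfMap Prod.fst q) + Hent (pmfMap Prod.snd q) - Hent q

/-- Conditional mutual information `I(X;Y|W)` of a joint pmf `q` of `((X,Y),W)`,
written as `H(X,W) + H(Y,W) - H(W) - H(X,Y,W)`. -/
noncomputable def cmi {α β W : Type*} [Fintype α] [Fintype β] [Fintype W]
    (q : (α × β) × W → ℝ) : ℝ :=
  Hent (pmfMap (fun x => (x.1.1, x.2)) q) + Hent (pmfMap (fun x => (x.1.2, x.2)) q)
    - Hent (pmfMap Prod.snd q) - Hent q

/-- The set of values `I(X,Y;W)` over all finite-alphabet `W` jointly distributed with `(X,Y)`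
(i.e. over all conditional distributions `p(w|x,y)`) such that `I(X;Y|W) ≤ γ`. -/
def relaxedSet {α β : Type*} [Fintype α] [Fintype β] (p : α × β → ℝ) (γ : ℝ) : Set ℝ :=
  { c | ∃ (m : ℕ) (q : (α × β) × Fin m → ℝ), IsPMF q ∧
      (pmfMap Prod.fst q = p) ∧ cmi q ≤ γ ∧ c = miW q }

/-- Relaxed Wyner's common information `C_γ(X;Y)` of a joint pmf `p` of `(X,Y)`. -/
noncomputable def Cgamma {α β : Type*} [Fintype α] [Fintype β] (p : α × β → ℝ) (γ : ℝ) : ℝ :=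
  sInf (relaxedSet p γ)

/-- Wyner's common information `C(X;Y)`: infimum of `I(X,Y;W)` over all finite-alphabet `W`
rendering `X` and `Y` conditionally independent, i.e. `I(X;Y|W) = 0`. -/
noncomputable def WynerCI {α β : Type*} [Fintype α] [Fintype β] (p : α × β → ℝ) : ℝ :=
  sInf { c | ∃ (m : ℕ) (q : (α × β) × Fin m → ℝ), IsPMF q ∧
      (pmfMap Prod.fst q = p) ∧ cmi q = 0 ∧ c = miW q }

end

theorem sum_pmfMap_mul {α β : Type*} [Fintype α] [Fintype β] (f : α → β) (p : α → ℝ)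
    (φ : β → ℝ) : ∑ b, pmfMap f p b * φ b = ∑ a, p a * φ (f a) := by
  simp only [pmfMap, Finset.sum_mul, ite_mul, zero_mul]
  rw [Finset.sum_comm]
  simp

theorem sum_pmfMap {α β : Type*} [Fintype α] [Fintype β] (f : α → β) (p : α → ℝ) :
    ∑ b, pmfMap f p b = ∑ a, p a := by
  simpa using sum_pmfMap_mul f p 1

theorem pmfMap_pmfMap {α β δ : Type*} [Fintype α] [Fintype β] (g : β → δ) (f : α → β)
    (p : α → ℝ) : pmfMap g (pmfMap f p) = pmfMap (fun a => g (f a)) p := by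
  funext c
  simpa [pmfMap] using sum_pmfMap_mul f p (fun b => if g b = c then 1 else 0)

theorem pmfMap_nonneg {α β : Type*} [Fintype α] (f : α → β) {p : α → ℝ} (hp : ∀ a, 0 ≤ p a)
    (b : β) : 0 ≤ pmfMap f p b :=
  Finset.sum_nonneg fun a _ => by split_ifs <;> simp [hp a]

theorem le_pmfMap_apply {α β : Type*} [Fintype α] (f : α → β) {p : α → ℝ} (hp : ∀ a, 0 ≤ p a)
    (a : α) : p a ≤ pmfMap f p (f a) := by
  have h := Finset.single_le_sum (f := fun x => if f x = f a then p x else 0)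
    (fun x _ => by split_ifs <;> simp [hp x]) (Finset.mem_univ a)
  simpa [pmfMap] using h

theorem pmfMap_apply_of_injective {α β : Type*} [Fintype α] {f : α → β}
    (hf : Function.Injective f) (p : α → ℝ) (a : α) : pmfMap f p (f a) = p a := by
  simp [pmfMap, hf.eq_iff]

theorem sum_pmfMap_pair_right {Ω A B : Type*} [Fintype Ω] [Fintype B]
    (f : Ω → A) (g : Ω → B) (q : Ω → ℝ) (a : A) :
    ∑ b, pmfMap (fun x => (f x, g x)) q (a, b) = pmfMap f q a := by
  simp only [pmfMap, Prod.mk.injEq]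
  rw [Finset.sum_comm]
  refine Finset.sum_congr rfl fun x _ => ?_
  by_cases h : f x = a <;> simp [h]

theorem Hent_pmfMap {α β : Type*} [Fintype α] [Fintype β] (f : α → β) (p : α → ℝ) :
    Hent (pmfMap f p) = -∑ a, p a * Real.log (pmfMap f p (f a)) := by
  rw [← sum_pmfMap_mul f p (fun b => Real.log (pmfMap f p b))]
  simp [Hent, Real.negMulLog]

theorem Hent_pmfMap_of_injective {α β : Type*} [Fintype α] [Fintype β] {f : α → β}
    (hf : Function.Injective f) (p : α → ℝ) : Hent (pmfMap f p) = Hent p := by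
  rw [Hent_pmfMap]
  simp [pmfMap_apply_of_injective hf, Hent, Real.negMulLog]

theorem sum_pmfMap_pair_mul_div {Ω A B C : Type*} [Fintype Ω] [Fintype A] [Fintype B] [Fintype C]
    (f : Ω → A) (g : Ω → B) (h : Ω → C) (q : Ω → ℝ) :
    ∑ t : A × B × C, pmfMap (fun x => (f x, g x)) q (t.1, t.2.1) *
      pmfMap (fun x => (f x, h x)) q (t.1, t.2.2) / pmfMap f q t.1 = ∑ x, q x := by
  rw [Fintype.sum_prod_type, ← sum_pmfMap f q]
  refine Finset.sum_congr rfl fun a _ => ?_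
  dsimp only
  rw [← Finset.sum_div, Fintype.sum_prod_type]
  dsimp only
  rw [← Finset.sum_mul_sum, sum_pmfMap_pair_right, sum_pmfMap_pair_right, mul_self_div_self]

/-- Submodularity of entropy: `H(F) + H(F,G,H) ≤ H(F,G) + H(F,H)`. -/
theorem Hent_submodular {Ω A B C : Type*} [Fintype Ω] [Fintype A] [Fintype B] [Fintype C]
    (f : Ω → A) (g : Ω → B) (h : Ω → C)
    (hinj : Function.Injective fun x => (f x, g x, h x)) {q : Ω → ℝ} (hq : ∀ x, 0 ≤ q x) :
    Hent (pmfMap f q) + Hent q ≤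
      Hent (pmfMap (fun x => (f x, g x)) q) + Hent (pmfMap (fun x => (f x, h x)) q) := by
  set F : A × B × C → ℝ := fun t => pmfMap (fun x => (f x, g x)) q (t.1, t.2.1) *
      pmfMap (fun x => (f x, h x)) q (t.1, t.2.2) / pmfMap f q t.1 with hF
  have hFnonneg : ∀ t, 0 ≤ F t := fun t =>
    div_nonneg (mul_nonneg (pmfMap_nonneg _ hq _) (pmfMap_nonneg _ hq _)) (pmfMap_nonneg _ hq _)
  have hsum : ∑ x, F (f x, g x, h x) ≤ ∑ x, q x := by
    rw [← sum_pmfMap_pair_mul_div f g h q,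
      ← Finset.sum_image (s := Finset.univ) (f := F) hinj.injOn]
    exact Finset.sum_le_sum_of_subset_of_nonneg (Finset.subset_univ _) fun t _ _ => hFnonneg t
  have hpt : ∀ x, q x * Real.log (pmfMap (fun x => (f x, g x)) q (f x, g x)) +
      q x * Real.log (pmfMap (fun x => (f x, h x)) q (f x, h x)) -
      q x * Real.log (pmfMap f q (f x)) - q x * Real.log (q x) ≤ F (f x, g x, h x) - q x := by
    intro x
    rcases (hq x).eq_or_lt with h0 | h0
    · simpa [← h0] using hFnonneg (f x, g x, h x)
    have h1 := h0.trans_le (le_pmfMap_apply f hq x)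
    have h2 := h0.trans_le (le_pmfMap_apply (fun x => (f x, g x)) hq x)
    have h3 := h0.trans_le (le_pmfMap_apply (fun x => (f x, h x)) hq x)
    have hFpos : 0 < F (f x, g x, h x) := div_pos (mul_pos h2 h3) h1
    have hlog := Real.log_le_sub_one_of_pos (div_pos hFpos h0)
    rw [Real.log_div hFpos.ne' h0.ne', hF, Real.log_div (mul_pos h2 h3).ne' h1.ne',
      Real.log_mul h2.ne' h3.ne', ← hF] at hlog
    calc _ = q x * (Real.log (pmfMap (fun x => (f x, g x)) q (f x, g x)) +
          Real.log (pmfMap (fun x => (f x, h x)) q (f x, h x)) -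
          Real.log (pmfMap f q (f x)) - Real.log (q x)) := by ring
      _ ≤ q x * (F (f x, g x, h x) / q x - 1) := mul_le_mul_of_nonneg_left hlog h0.le
      _ = F (f x, g x, h x) - q x := by field_simp
  have htot := Finset.sum_le_sum fun x (_ : x ∈ Finset.univ) => hpt x
  simp only [Finset.sum_add_distrib, Finset.sum_sub_distrib] at htot
  rw [Hent_pmfMap f, Hent_pmfMap (fun x => (f x, g x)), Hent_pmfMap (fun x => (f x, h x))]
  have hHq : Hent q = -∑ x, q x * Real.log (q x) := by simp [Hent, Real.negMulLog]
  linarith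

theorem Hent_pmfMap_unit_prod {Ω δ : Type*} [Fintype Ω] [Fintype δ] (r : Ω → δ) (q : Ω → ℝ) :
    Hent (pmfMap (fun x => ((), r x)) q) = Hent (pmfMap r q) := by
  rw [← pmfMap_pmfMap (fun d => ((), d)) r q]
  exact Hent_pmfMap_of_injective (Prod.mk_right_injective ()) _

theorem miW_nonneg {α β W : Type*} [Fintype α] [Fintype β] [Fintype W]
    {q : (α × β) × W → ℝ} (hq : IsPMF q) : 0 ≤ miW q := by
  have h := Hent_submodular (fun _ => ()) (Prod.fst : (α × β) × W → α × β) Prod.snd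
    (fun x y hxy => by simpa [Prod.ext_iff] using hxy) hq.1
  rw [Hent_pmfMap_unit_prod, Hent_pmfMap_unit_prod] at h
  have h0 : Hent (pmfMap (fun _ => ()) q) = 0 := by
    simp [Hent, pmfMap, hq.2]
  unfold miW
  linarith

theorem mi_sub_cmi_le_miW {α β W : Type*} [Fintype α] [Fintype β] [Fintype W]
    {q : (α × β) × W → ℝ} (hq : ∀ x, 0 ≤ q x) :
    mi (pmfMap Prod.fst q) - cmi q ≤ miW q := by
  have hX := Hent_submodular (fun x : (α × β) × W => x.1.1) (fun x => x.1.2) (fun x => x.2)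
    (fun x y hxy => by simpa [Prod.ext_iff, and_assoc] using hxy) hq
  have hY := Hent_submodular (fun x : (α × β) × W => x.1.2) (fun x => x.1.1) (fun x => x.2)
    (fun x y hxy => by
      simp only [Prod.ext_iff] at hxy ⊢
      exact ⟨⟨hxy.2.1, hxy.1⟩, hxy.2.2⟩) hq
  have hswap : Hent (pmfMap (fun x : (α × β) × W => (x.1.2, x.1.1)) q) =
      Hent (pmfMap Prod.fst q) := by
    rw [← Hent_pmfMap_of_injective Prod.swap_injective (pmfMap Prod.fst q), pmfMap_pmfMap]
    rfl
  rw [hswap] at hY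
  change _ ≤ Hent (pmfMap Prod.fst q) + _ at hX
  simp only [mi, miW, cmi, pmfMap_pmfMap]
  linarith

theorem relaxedSet_nonempty {α β : Type*} [Fintype α] [Fintype β] {p : α × β → ℝ}
    (hp : IsPMF p) {γ : ℝ} (hγ : 0 ≤ γ) : (relaxedSet p γ).Nonempty := by
  set e := Fintype.equivFin (α × β)
  refine ⟨_, _, pmfMap (fun x => (x, e x)) p,
    ⟨pmfMap_nonneg _ hp.1, (sum_pmfMap _ _).trans hp.2⟩, ?_, ?_, rfl⟩
  · rw [pmfMap_pmfMap]
    funext x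
    exact pmfMap_apply_of_injective Function.injective_id p x
  · simp only [cmi, pmfMap_pmfMap]
    rw [Hent_pmfMap_of_injective, Hent_pmfMap_of_injective, Hent_pmfMap_of_injective,
      Hent_pmfMap_of_injective]
    · linarith
    all_goals intro x y hxy; simp_all

/-- For finite-alphabet `X, Y` and `γ ≥ 0`:
`C_γ(X;Y) ≥ max{I(X;Y) − γ, 0}`. -/
theorem relaxedWyner_lower_bound
    {α β : Type*} [Fintype α] [Fintype β] (p : α × β → ℝ) (hp : IsPMF p)
    (γ : ℝ) (hγ : 0 ≤ γ) :
    max (mi p - γ) 0 ≤ Cgamma p γ := by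
  refine le_csInf (relaxedSet_nonempty hp hγ) ?_
  rintro _ ⟨m, q, hq, rfl, hcmi, rfl⟩
  exact max_le (by linarith [mi_sub_cmi_le_miW hq.1]) (miW_nonneg hq)
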